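/- Let a be an involutive homeomorphism of a compact Hausdorff totally disconnected space X, let Fix_a = {x ∈ X : a(x) = x} and let G_a := {f ∈ C(X,ℤ) : f∘a = f and f(x) ∈ 2ℤ for every x ∈ Fix_a}. Then the group homomorphism ψ : C(X,ℤ) → C(X,ℤ), f ↦ f + f∘a, has image exactly G_a and kernel exactly {g − g∘a : g ∈ C(X,ℤ)}. Consequently the coinvariants C(X,ℤ)/{g − g∘a} are isomorphic to G_a, and H_{2k}(ℤ/2, C(X,ℤ)) = 0 for every k ≥ 1. -/

import Mathlib

section GroupHomologyDef

variable (G M : Type*) [Group G] [AddCommGroup M] [DistribMulAction G M]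

/-- The differential on inhomogeneous chains computing the homology of the group `G` with
coefficients in the `G`-module `M` (for the left action of `G` on `M`; a right module is
regarded as a left module by acting by inverses, which does not change homology). -/
noncomputable def inhomogeneousChainsD (n : ℕ) :
    ((Fin (n + 1) → G) →₀ M) →+ ((Fin n → G) →₀ M) :=
  Finsupp.liftAddHom fun g =>
    { toFun := fun m =>
        Finsupp.single (fun i => g i.succ) ((g 0)⁻¹ • m) +
          ∑ j : Fin (n + 1),
            (-1 : ℤ) ^ ((j : ℕ) + 1) • Finsupp.single (Fin.contractNth j (· * ·) g) m
      map_zero' := by simp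
      map_add' := fun a b => by
        simp only [smul_add, Finsupp.single_add, Finset.sum_add_distrib]
        abel }

/-- The subgroup of `n`-cycles of the complex of inhomogeneous chains. -/
noncomputable def homologyCycles : ∀ n : ℕ, AddSubgroup ((Fin n → G) →₀ M)
  | 0 => ⊤
  | (m + 1) => (inhomogeneousChainsD G M m).ker

/-- The `n`-th homology group `Hₙ(G, M)` of the group `G` with coefficients in the
`G`-module `M`: the quotient of the `n`-cycles by the `n`-boundaries of the complex of
inhomogeneous chains. -/
noncomputable def GroupHomology (n : ℕ) : Type _ :=
  homologyCycles G M n ⧸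
    ((inhomogeneousChainsD G M n).range.addSubgroupOf (homologyCycles G M n))

noncomputable instance (n : ℕ) : AddCommGroup (GroupHomology G M n) :=
  QuotientAddGroup.Quotient.addCommGroup _

end GroupHomologyDef

variable {X : Type*} [TopologicalSpace X]

/-- The subgroup `G_a = {f ∈ C(X, ℤ) : f ∘ a = f and f(Fix_a) ⊆ 2ℤ}`. -/
def evenOnFixSubgroup (a : X ≃ₜ X) : AddSubgroup C(X, ℤ) where
  carrier := {f | f.comp (a : C(X, X)) = f ∧ ∀ x : X, a x = x → (2 : ℤ) ∣ f x}
  zero_mem' := ⟨by ext x; simp, fun x _ => dvd_zero 2⟩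
  add_mem' := by
    rintro f g ⟨hf1, hf2⟩ ⟨hg1, hg2⟩
    refine ⟨by rw [ContinuousMap.add_comp, hf1, hg1], fun x hx => ?_⟩
    simpa using dvd_add (hf2 x hx) (hg2 x hx)
  neg_mem' := by
    rintro f ⟨hf1, hf2⟩
    refine ⟨by rw [ContinuousMap.neg_comp, hf1], fun x hx => ?_⟩
    simpa using (hf2 x hx).neg_right

/-- The subgroup `{g - g ∘ ψ : g ∈ C(Z, ℤ)}` of `C(Z, ℤ)`. -/
def coboundariesSubgroup {Z : Type*} [TopologicalSpace Z] (ψ : C(Z, Z)) :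
    AddSubgroup C(Z, ℤ) :=
  (AddMonoidHom.mk' (fun h : C(Z, ℤ) => h - h.comp ψ)
    (fun f g => by ext x; simp; ring)).range

section Representatives

variable {Y : Type*} [TopologicalSpace Y] {a : Y ≃ₜ Y}

/-- A clopen set disjoint from its image under `a` extends to one whose orbit also covers the
orbit of a second such set. -/
theorem exists_isClopen_disjoint_preimage_union (ha : ∀ x, a (a x) = x) {V W : Set Y}
    (hV : IsClopen V) (hW : IsClopen W) (hVa : Disjoint V (a ⁻¹' V))
    (hWa : Disjoint W (a ⁻¹' W)) :
    ∃ Z : Set Y, IsClopen Z ∧ Disjoint Z (a ⁻¹' Z) ∧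
      (V ∪ a ⁻¹' V) ∪ (W ∪ a ⁻¹' W) ⊆ Z ∪ a ⁻¹' Z := by
  refine ⟨V ∪ W \ (V ∪ a ⁻¹' V), hV.union (hW.diff (hV.union (hV.preimage a.continuous))), ?_, ?_⟩
  · rw [Set.disjoint_left] at hVa hWa ⊢
    intro x hx hx'
    have := @hVa x
    have := @hVa (a x)
    have := @hWa x
    simp only [Set.mem_union, Set.mem_sdiff, Set.mem_preimage, ha] at *
    tauto
  · intro x hx
    simp only [Set.mem_union, Set.mem_sdiff, Set.mem_preimage, ha] at *
    tauto

/-- An involution acting freely on a clopen set `O` admits a clopen set of orbit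
representatives for `O`. -/
theorem exists_isClopen_disjoint_preimage_cover [CompactSpace Y] [T2Space Y]
    [TotallyDisconnectedSpace Y] (ha : ∀ x, a (a x) = x) {O : Set Y} (hO : IsClosed O)
    (hfree : ∀ x ∈ O, a x ≠ x) :
    ∃ V : Set Y, IsClopen V ∧ Disjoint V (a ⁻¹' V) ∧ O ⊆ V ∪ a ⁻¹' V := by
  refine hO.isCompact.induction_on
    (p := fun S => ∃ V : Set Y, IsClopen V ∧ Disjoint V (a ⁻¹' V) ∧ S ⊆ V ∪ a ⁻¹' V)
    ⟨∅, isClopen_empty, by simp, by simp⟩ ?_ ?_ ?_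
  · rintro S T hST ⟨V, hV, hVa, hTV⟩
    exact ⟨V, hV, hVa, hST.trans hTV⟩
  · rintro S T ⟨V, hV, hVa, hSV⟩ ⟨W, hW, hWa, hTW⟩
    obtain ⟨Z, hZ, hZa, hsub⟩ := exists_isClopen_disjoint_preimage_union ha hV hW hVa hWa
    exact ⟨Z, hZ, hZa, (Set.union_subset_union hSV hTW).trans hsub⟩
  · intro x hx
    obtain ⟨U, hU, hxU, hxU'⟩ := exists_isClopen_of_totally_separated (hfree x hx).symm
    refine ⟨U \ a ⁻¹' U, mem_nhdsWithin_of_mem_nhds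
      ((hU.diff (hU.preimage a.continuous)).isOpen.mem_nhds ⟨hxU, hxU'⟩),
      U \ a ⁻¹' U, hU.diff (hU.preimage a.continuous), ?_, Set.subset_union_left⟩
    rw [Set.disjoint_left]
    rintro y ⟨-, hy⟩ ⟨hay, -⟩
    exact hy hay

/-- The image of `f ↦ f + f ∘ a` consists of the invariant functions that are even on the fixed
points of `a`. -/
theorem exists_eq_add_comp_iff_mem_evenOnFixSubgroup [CompactSpace Y] [T2Space Y]
    [TotallyDisconnectedSpace Y] (ha : ∀ x, a (a x) = x) (f : C(Y, ℤ)) :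
    (∃ g : C(Y, ℤ), f = g + g.comp (a : C(Y, Y))) ↔ f ∈ evenOnFixSubgroup a := by
  classical
  constructor
  · rintro ⟨g, rfl⟩
    refine ⟨?_, fun x hx => ⟨g x, ?_⟩⟩
    · ext x
      simp [ha, add_comm]
    · simp [hx, two_mul]
  · rintro ⟨hinv, heven⟩
    have hfa : ∀ x, f (a x) = f x := fun x => DFunLike.congr_fun hinv x
    have hO : IsClosed {x | ¬ (2 : ℤ) ∣ f x} :=
      (isClosed_discrete {n : ℤ | ¬ (2 : ℤ) ∣ n}).preimage f.continuous
    obtain ⟨V, hV, hVa, hcover⟩ := exists_isClopen_disjoint_preimage_cover ha hO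
      fun x hx hax => hx (heven x hax)
    have hhalf (c : ℤ) : Continuous fun x => (f x + c) / 2 :=
      (continuous_of_discreteTopology (f := fun n : ℤ => (n + c) / 2)).comp f.continuous
    refine ⟨⟨V.piecewise (fun x => (f x + 1) / 2) fun x => (f x + 0) / 2, ?_⟩, ?_⟩
    · exact (hhalf 1).piecewise (by simp [hV.frontier_eq]) (hhalf 0)
    · ext x
      have h₁ : x ∈ {x | ¬ (2 : ℤ) ∣ f x} → x ∈ V ∪ a ⁻¹' V := fun hx => hcover hx
      have h₂ : x ∈ V → x ∉ a ⁻¹' V := fun hx => Set.disjoint_left.mp hVa hx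
      simp only [Set.mem_ofPred_eq, Set.mem_union, Set.mem_preimage] at h₁ h₂
      by_cases hx : x ∈ V <;> by_cases hax : a x ∈ V <;>
        simp [Set.piecewise, hx, hax, hfa] at h₁ h₂ ⊢ <;> omega

/-- The kernel of `f ↦ f + f ∘ a` consists of the coboundaries. -/
theorem add_comp_eq_zero_iff_mem_coboundariesSubgroup (ha : ∀ x, a (a x) = x) (g : C(Y, ℤ)) :
    g + g.comp (a : C(Y, Y)) = 0 ↔ g ∈ coboundariesSubgroup (a : C(Y, Y)) := by
  constructor
  · intro h
    have hga : ∀ x, g x + g (a x) = 0 := fun x => DFunLike.congr_fun h x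
    refine ⟨g ⊔ 0, ?_⟩
    ext x
    have := hga x
    simp only [AddMonoidHom.mk'_apply, ContinuousMap.sub_apply, ContinuousMap.sup_apply,
      ContinuousMap.zero_apply, ContinuousMap.comp_apply, ContinuousMap.coe_coe]
    omega
  · rintro ⟨h, rfl⟩
    ext x
    simp [ha]

/-- The homomorphism `f ↦ f + f ∘ a`. -/
def addCompHom (a : Y ≃ₜ Y) : C(Y, ℤ) →+ C(Y, ℤ) :=
  AddMonoidHom.mk' (fun g => g + g.comp (a : C(Y, Y))) fun f g => by
    rw [ContinuousMap.add_comp]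
    abel

/-- The coinvariants of an involution are the invariant functions that are even on its fixed
points. -/
theorem nonempty_coinvariants_addEquiv_evenOnFixSubgroup [CompactSpace Y] [T2Space Y]
    [TotallyDisconnectedSpace Y] (ha : ∀ x, a (a x) = x) :
    Nonempty ((C(Y, ℤ) ⧸ coboundariesSubgroup (a : C(Y, Y))) ≃+ evenOnFixSubgroup a) := by
  have hker : coboundariesSubgroup (a : C(Y, Y)) = (addCompHom a).ker := by
    ext g
    exact (add_comp_eq_zero_iff_mem_coboundariesSubgroup ha g).symm
  have hrange : (addCompHom a).range = evenOnFixSubgroup a := by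
    ext f
    rw [← exists_eq_add_comp_iff_mem_evenOnFixSubgroup ha f]
    exact exists_congr fun g => eq_comm
  exact ⟨(QuotientAddGroup.quotientAddEquivOfEq hker).trans
    ((QuotientAddGroup.quotientKerEquivRange (addCompHom a)).trans
      (AddEquiv.addSubgroupCongr hrange))⟩

end Representatives

section GroupHomologyVanishing

theorem inhomogeneousChainsD_single {G M : Type*} [Group G] [AddCommGroup M]
    [DistribMulAction G M] (n : ℕ) (g : Fin (n + 1) → G) (m : M) :
    inhomogeneousChainsD G M n (Finsupp.single g m) =
      Finsupp.single (fun i => g i.succ) ((g 0)⁻¹ • m) +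
        ∑ j : Fin (n + 1),
          (-1 : ℤ) ^ ((j : ℕ) + 1) • Finsupp.single (Fin.contractNth j (· * ·) g) m := by
  simp [inhomogeneousChainsD]

/-- The inhomogeneous chain complexes of isomorphic groups acting compatibly are isomorphic. -/
theorem inhomogeneousChainsD_domCongr {G H M : Type*} [Group G] [Group H] [AddCommGroup M]
    [DistribMulAction G M] [DistribMulAction H M] (e : G ≃* H)
    (he : ∀ (g : G) (m : M), e g • m = g • m) (n : ℕ) (x : (Fin (n + 1) → G) →₀ M) :
    inhomogeneousChainsD H M n
        (Finsupp.domCongr (Equiv.arrowCongr (Equiv.refl _) e.toEquiv) x) =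
      Finsupp.domCongr (Equiv.arrowCongr (Equiv.refl _) e.toEquiv)
        (inhomogeneousChainsD G M n x) := by
  induction x using Finsupp.induction_linear with
  | zero => simp
  | add x y hx hy => simp only [map_add, hx, hy]
  | single g m =>
    simp only [inhomogeneousChainsD_single, map_add, map_sum, map_zsmul,
      Finsupp.domCongr_apply, Finsupp.equivMapDomain_single]
    congr 1
    · simp [Equiv.arrowCongr, ← map_inv, he, Function.comp_def]
    · simp [Equiv.arrowCongr, Fin.comp_contractNth _ _ (map_mul e)]

universe u

/-- The representation over `ULift ℤ` underlying a distributive group action. -/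
def uliftIntRepresentation (G M : Type u) [Group G] [AddCommGroup M] [DistribMulAction G M] :
    Representation (ULift.{u} ℤ) G M where
  toFun g :=
    { toFun := fun m => g • m
      map_add' := smul_add g
      map_smul' := fun z m => (smul_comm g z.down m) }
  map_one' := by ext; simp
  map_mul' g h := by ext; simp [mul_smul]

theorem inhomogeneousChains_d_uliftIntRepresentation {G M : Type u} [Group G] [AddCommGroup M]
    [DistribMulAction G M] (n : ℕ) (x : (Fin (n + 1) → G) →₀ M) :
    groupHomology.inhomogeneousChains.d (Rep.of (uliftIntRepresentation G M)) n x =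
      inhomogeneousChainsD G M n x := by
  induction x using Finsupp.induction_linear with
  | zero => simp
  | add x y hx hy => rw [map_add, map_add, hx, hy]
  | single g m =>
    rw [inhomogeneousChainsD_single, groupHomology.inhomogeneousChains.d_single]
    congr 1

/-- Vanishing of positive even homology of a finite cyclic group. -/
theorem exists_inhomogeneousChainsD_eq_of_norm_exact {G M : Type u} [CommGroup G] [Fintype G]
    [AddCommGroup M] [DistribMulAction G M] (g : G) (hg : ∀ x, x ∈ Subgroup.zpowers g)
    (hM : ∀ m : M, ∑ h : G, h • m = 0 → ∃ m', g • m' - m' = m) {n : ℕ} (hn : Even (n + 1))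
    (x : (Fin (n + 1) → G) →₀ M) (hx : inhomogeneousChainsD G M n x = 0) :
    ∃ y, inhomogeneousChainsD G M (n + 1) y = x := by
  classical
  let A := Rep.of (uliftIntRepresentation G M)
  have hexact : (Rep.FiniteCyclicGroup.subCompNormHom A g).Exact := by
    rw [CategoryTheory.ShortComplex.moduleCat_exact_iff]
    intro m hm
    obtain ⟨m', hm'⟩ := hM m (by
      simpa [A, Rep.norm, Representation.norm, uliftIntRepresentation] using! hm)
    refine ⟨m', ?_⟩
    simpa [A, Rep.sub_hom, Rep.applyAsHom, uliftIntRepresentation] using! hm'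
  have hzero : CategoryTheory.Limits.IsZero (groupHomology A (n + 1)) :=
    (CategoryTheory.ShortComplex.exact_iff_isZero_homology _ |>.1 hexact).of_iso
      (Rep.FiniteCyclicGroup.groupHomologyIsoEven A g hg (n + 1) hn)
  have hexactAt : (groupHomology.inhomogeneousChains A).ExactAt (n + 1) :=
    (HomologicalComplex.exactAt_iff_isZero_homology _ _).2 hzero
  rw [HomologicalComplex.exactAt_iff' _ (n + 2) (n + 1) n (by simp) (by simp),
    CategoryTheory.ShortComplex.moduleCat_exact_iff] at hexactAt
  obtain ⟨y, hy⟩ := hexactAt x (by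
    simpa [groupHomology.inhomogeneousChains.d_def] using!
      (inhomogeneousChains_d_uliftIntRepresentation n x).trans hx)
  refine ⟨y, ?_⟩
  refine (inhomogeneousChains_d_uliftIntRepresentation (n + 1) y).symm.trans ?_
  rw [← groupHomology.inhomogeneousChains.d_def]
  exact hy

/-- Vanishing of positive even homology of a finite cyclic group, as a statement about
`GroupHomology`. -/
theorem GroupHomology.eq_zero_of_norm_exact {G : Type} {M : Type u} [CommGroup G] [Fintype G]
    [AddCommGroup M] [DistribMulAction G M] (g : G) (hg : ∀ x, x ∈ Subgroup.zpowers g)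
    (hM : ∀ m : M, ∑ h : G, h • m = 0 → ∃ m', g • m' - m' = m) {n : ℕ} (hn : Even (n + 1))
    (x : GroupHomology G M (n + 1)) : x = 0 := by
  obtain ⟨⟨c, hc⟩, rfl⟩ := QuotientAddGroup.mk_surjective x
  refine (QuotientAddGroup.eq_zero_iff _).2 ?_
  change inhomogeneousChainsD G M n c = 0 at hc
  change c ∈ (inhomogeneousChainsD G M (n + 1)).range
  let e : G ≃* ULift.{u} G := MulEquiv.ulift.symm
  have he : ∀ (g : G) (m : M), e g • m = g • m := fun _ _ => rfl
  obtain ⟨y, hy⟩ := exists_inhomogeneousChainsD_eq_of_norm_exact (G := ULift.{u} G) (M := M) (e g)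
    (fun x => by
      obtain ⟨i, hi⟩ := hg (e.symm x)
      refine ⟨i, ?_⟩
      apply e.symm.injective
      simpa using! hi)
    (fun m hm => hM m (by
      rw [← hm]
      exact Fintype.sum_equiv e.toEquiv _ _ fun _ => rfl))
    hn (Finsupp.domCongr (Equiv.arrowCongr (Equiv.refl _) e.toEquiv) c)
    (by rw [inhomogeneousChainsD_domCongr e he, hc, map_zero])
  refine ⟨(Finsupp.domCongr (Equiv.arrowCongr (Equiv.refl _) e.toEquiv)).symm y, ?_⟩
  apply (Finsupp.domCongr (Equiv.arrowCongr (Equiv.refl (Fin (n + 1))) e.toEquiv)).injective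
  rw [← inhomogeneousChainsD_domCongr e he, AddEquiv.apply_symm_apply, hy]

end GroupHomologyVanishing

/-- Let `a` be an involutive homeomorphism of a compact Hausdorff totally disconnected space
`X`.  The homomorphism `ψ : C(X, ℤ) → C(X, ℤ)`, `f ↦ f + f ∘ a`, has image exactly
`G_a = {f : f ∘ a = f, f(Fix_a) ⊆ 2ℤ}` and kernel exactly `{g - g ∘ a}`; consequently the
coinvariants `C(X, ℤ) / {g - g ∘ a}` are isomorphic to `G_a`, and
`H_{2k}(ℤ/2, C(X, ℤ)) = 0` for every `k ≥ 1`. -/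
theorem even_homology_of_involution {Y : Type*} [TopologicalSpace Y] [CompactSpace Y]
    [T2Space Y] [TotallyDisconnectedSpace Y] (a : Y ≃ₜ Y) (ha : ∀ x, a (a x) = x)
    [DistribMulAction (Multiplicative (ZMod 2)) C(Y, ℤ)]
    (hact : ∀ f : C(Y, ℤ),
      Multiplicative.ofAdd (1 : ZMod 2) • f = f.comp (a : C(Y, Y))) :
    (∀ f : C(Y, ℤ),
      (∃ g : C(Y, ℤ), f = g + g.comp (a : C(Y, Y))) ↔ f ∈ evenOnFixSubgroup a) ∧
    (∀ g : C(Y, ℤ),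
      g + g.comp (a : C(Y, Y)) = 0 ↔ g ∈ coboundariesSubgroup (a : C(Y, Y))) ∧
    Nonempty ((C(Y, ℤ) ⧸ coboundariesSubgroup (a : C(Y, Y))) ≃+ evenOnFixSubgroup a) ∧
    (∀ k : ℕ, 1 ≤ k →
      ∀ x : GroupHomology (Multiplicative (ZMod 2)) C(Y, ℤ) (2 * k), x = 0) := by
  refine ⟨exists_eq_add_comp_iff_mem_evenOnFixSubgroup ha,
    add_comp_eq_zero_iff_mem_coboundariesSubgroup ha,
    nonempty_coinvariants_addEquiv_evenOnFixSubgroup ha, ?_⟩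
  intro k hk x
  obtain ⟨k, rfl⟩ := Nat.exists_eq_add_of_le' hk
  refine GroupHomology.eq_zero_of_norm_exact (n := 2 * k + 1)
    (Multiplicative.ofAdd (1 : ZMod 2)) (fun x => ?_) (fun f hf => ?_) ⟨k + 1, by ring⟩ x
  · obtain ⟨i, hi⟩ : ∃ i : Fin 2, Multiplicative.ofAdd (1 : ZMod 2) ^ (i : ℕ) = x := by
      revert x
      decide
    exact ⟨(i : ℕ), by simpa using hi⟩
  have hsum : f + f.comp (a : C(Y, Y)) = 0 := by
    rw [← hact, ← hf]
    rw [show (Finset.univ : Finset (Multiplicative (ZMod 2))) =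
      {1, Multiplicative.ofAdd 1} by decide, Finset.sum_pair (by decide), one_smul]
  obtain ⟨h, rfl⟩ := (add_comp_eq_zero_iff_mem_coboundariesSubgroup ha f).1 hsum
  refine ⟨-h, ?_⟩
  rw [smul_neg, hact, AddMonoidHom.mk'_apply]
  abel
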